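/- Let W be a real m×n matrix whose i-th row is ψ_i ∈ ℝⁿ, let M be a real n×m matrix with M·W = I_n whose j-th column is ψ†_j ∈ ℝⁿ, let x ∈ ℝⁿ with μ_i(x) = ⟨ψ_i, x⟩, and let ε be a random vector in ℝⁿ with independent coordinates each distributed N(0,σ²), σ > 0. Then the overcomplete ideal risk is bounded by the upper-bound risk: min over δ ∈ {0,1}^m of E‖x − M D_δ W (x + ε)‖² ≤ R_up(x,W) = Σ_{k=1}^m min( Σ_{j=1}^m |μ_k(x) μ_j(x) ⟨ψ†_k, ψ†_j⟩|, σ² Σ_{j=1}^m |⟨ψ†_k, ψ†_j⟩ ⟨ψ_k, ψ_j⟩| ). -/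

import Mathlib

open MeasureTheory ProbabilityTheory Matrix Finset NNReal


lemma aux_memLp (n : ℕ) (v : ℝ≥0) (b : Fin n → ℝ) :
    MemLp (fun ε : Fin n → ℝ => ∑ l, b l * ε l) 2
      (Measure.pi fun _ : Fin n => gaussianReal 0 v) := by
  refine memLp_finsetSum _ fun l _ => ?_
  have h : MemLp (fun t : ℝ => b l * t) 2 (gaussianReal 0 v) :=
    (memLp_id_gaussianReal 2).const_mul (b l)
  exact h.comp_measurePreserving (measurePreserving_eval (fun _ : Fin n => gaussianReal 0 v) l)

lemma aux_mean (n : ℕ) (v : ℝ≥0) (b : Fin n → ℝ) :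
    ∫ ε : Fin n → ℝ, (∑ l, b l * ε l)
      ∂(Measure.pi fun _ : Fin n => gaussianReal 0 v) = 0 := by
  have hm : ∀ l : Fin n, MemLp (fun ε : Fin n → ℝ => ε l) 2
      (Measure.pi fun _ : Fin n => gaussianReal 0 v) := fun l =>
    (memLp_id_gaussianReal 2).comp_measurePreserving
      (measurePreserving_eval (fun _ : Fin n => gaussianReal 0 v) l)
  rw [integral_finsetSum]
  · refine Finset.sum_eq_zero fun l _ => ?_
    rw [integral_const_mul]
    have := integral_comp_eval (μ := fun _ : Fin n => gaussianReal 0 v) (i := l)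
      (f := fun t : ℝ => t) (by fun_prop)
    rw [this]
    simp
  · intro l _
    exact ((hm l).integrable (by norm_num)).const_mul _

lemma aux_sq (n : ℕ) (v : ℝ≥0) (b : Fin n → ℝ) :
    ∫ ε : Fin n → ℝ, (∑ l, b l * ε l) ^ 2
      ∂(Measure.pi fun _ : Fin n => gaussianReal 0 v) = v * ∑ l, b l ^ 2 := by
  have h1 := variance_eq_sub (aux_memLp n v b)
  rw [aux_mean] at h1
  have h2 := variance_sum_pi (μ := fun _ : Fin n => gaussianReal 0 v)
    (X := fun l t => b l * t) (fun l => (memLp_id_gaussianReal 2).const_mul (b l))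
  have h3 : (∑ l, fun ε : Fin n → ℝ => b l * ε l) = fun ε => ∑ l, b l * ε l := by
    ext ε; simp
  rw [h3, h1] at h2
  simp only [Pi.pow_apply] at h2
  have h4 : ∀ l, Var[fun t => b l * t; gaussianReal 0 v] = b l ^ 2 * v := by
    intro l
    rw [variance_const_mul]
    congr 1
    exact variance_fun_id_gaussianReal
  simp only [h4] at h2
  rw [Finset.mul_sum]
  simp only [mul_comm (v : ℝ)]
  linarith

lemma aux_int (n : ℕ) (v : ℝ≥0) (a : ℝ) (b : Fin n → ℝ) :
    Integrable (fun ε : Fin n → ℝ => (a - ∑ l, b l * ε l) ^ 2)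
      (Measure.pi fun _ : Fin n => gaussianReal 0 v) :=
  ((memLp_const a).sub (aux_memLp n v b)).integrable_sq

lemma aux_risk (n : ℕ) (v : ℝ≥0) (a : ℝ) (b : Fin n → ℝ) :
    ∫ ε : Fin n → ℝ, (a - ∑ l, b l * ε l) ^ 2
      ∂(Measure.pi fun _ : Fin n => gaussianReal 0 v) = a ^ 2 + v * ∑ l, b l ^ 2 := by
  have hY := aux_memLp n v b
  have e : ∀ ε : Fin n → ℝ, (a - ∑ l, b l * ε l) ^ 2
      = (a ^ 2 - 2 * a * (∑ l, b l * ε l)) + (∑ l, b l * ε l) ^ 2 := fun ε => by ring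
  simp only [e]
  rw [integral_add, integral_sub, integral_const_mul, aux_mean, aux_sq]
  · simp
  · exact integrable_const _
  · exact (hY.integrable (by norm_num)).const_mul _
  · exact (integrable_const _).sub ((hY.integrable (by norm_num)).const_mul _)
  · exact hY.integrable_sq

lemma aux_comb {m n : ℕ} (M : Matrix (Fin n) (Fin m) ℝ) (c : Fin m → ℝ) :
    ∑ i, (∑ k, M i k * c k) ^ 2 = ∑ k, ∑ j, c k * c j * ∑ i, M i k * M i j := by
  simp only [sq, Finset.sum_mul_sum]
  simp only [Finset.mul_sum]
  rw [Finset.sum_comm]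
  refine Finset.sum_congr rfl fun k _ => ?_
  rw [Finset.sum_comm]
  refine Finset.sum_congr rfl fun j _ => Finset.sum_congr rfl fun i _ => ?_
  ring

lemma aux_bound {m : ℕ} (d : Fin m → ℝ) (hd : ∀ i, d i = 0 ∨ d i = 1)
    (A : Fin m → Fin m → ℝ) :
    ∑ k, ∑ j, d k * d j * A k j ≤ ∑ k, d k * ∑ j, |A k j| := by
  refine Finset.sum_le_sum fun k _ => ?_
  rw [Finset.mul_sum]
  refine Finset.sum_le_sum fun j _ => ?_
  have h0 := abs_nonneg (A k j)
  have h1 := le_abs_self (A k j)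
  rcases hd k with h | h <;> rcases hd j with h' | h' <;> simp [h, h', h1]

/-- The overcomplete ideal risk
`min_{δ ∈ {0,1}^m} E‖x − M D_δ W (x + ε)‖²` is bounded above by the upper-bound risk
`R_up(x,W) = ∑_k min(∑_j |μ_k(x) μ_j(x) ⟨ψ†_k, ψ†_j⟩|, σ² ∑_j |⟨ψ†_k, ψ†_j⟩ ⟨ψ_k, ψ_j⟩|)`,
where `ψ_i` are the rows of `W`, `ψ†_j` the columns of the left inverse `M`, and
`μ_i(x) = ⟨ψ_i, x⟩ = (Wx)_i`. -/
theorem overcomplete_paper_stmt7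
    (m n : ℕ) (W : Matrix (Fin m) (Fin n) ℝ) (M : Matrix (Fin n) (Fin m) ℝ)
    (hMW : M * W = 1)
    (x : Fin n → ℝ) (σ : ℝ≥0) (hσ : 0 < σ) :
    sInf {r : ℝ | ∃ δ : Fin m → ℝ, (∀ i, δ i = 0 ∨ δ i = 1) ∧
        r = ∫ ε : Fin n → ℝ,
            ‖(EuclideanSpace.equiv (Fin n) ℝ).symm
                (x - M.mulVec ((Matrix.diagonal δ).mulVec (W.mulVec (x + ε))))‖ ^ 2
            ∂(Measure.pi fun _ : Fin n => gaussianReal 0 (σ ^ 2))}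
      ≤ ∑ k, min
          (∑ j, |(W.mulVec x k) * (W.mulVec x j) * (∑ i, M i k * M i j)|)
          ((σ : ℝ) ^ 2 * ∑ j, |(∑ i, M i k * M i j) * (∑ i, W k i * W j i)|) := by
  classical
  set U : Fin m → ℝ := fun k => ∑ j, |(W.mulVec x k) * (W.mulVec x j) * (∑ i, M i k * M i j)|
    with hU
  set S : Fin m → ℝ := fun k => (σ : ℝ) ^ 2 *
    ∑ j, |(∑ i, M i k * M i j) * (∑ i, W k i * W j i)| with hS
  let δ : Fin m → ℝ := fun k => if U k ≤ S k then 0 else 1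
  have hδ : ∀ i, δ i = 0 ∨ δ i = 1 := fun i => by
    by_cases h : U i ≤ S i <;> simp [δ, h]
  have hδ' : ∀ i, 1 - δ i = 0 ∨ 1 - δ i = 1 := fun i => by
    rcases hδ i with h | h <;> simp [h]
  refine le_trans (csInf_le (a := ∫ ε : Fin n → ℝ, ‖(EuclideanSpace.equiv (Fin n) ℝ).symm
      (x - M.mulVec ((Matrix.diagonal δ).mulVec (W.mulVec (x + ε))))‖ ^ 2
      ∂(Measure.pi fun _ : Fin n => gaussianReal 0 (σ ^ 2))) ⟨0, ?_⟩ ⟨δ, hδ, rfl⟩) ?_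
  · rintro r ⟨d, -, rfl⟩
    exact integral_nonneg fun ε => by positivity
  have hx : ∀ i, x i = ∑ k, M i k * W.mulVec x k := by
    intro i
    have h : M.mulVec (W.mulVec x) = x := by rw [Matrix.mulVec_mulVec, hMW, Matrix.one_mulVec]
    conv_lhs => rw [← h]
    rfl
  have hpt : ∀ ε : Fin n → ℝ, ‖(EuclideanSpace.equiv (Fin n) ℝ).symm
      (x - M.mulVec ((Matrix.diagonal δ).mulVec (W.mulVec (x + ε))))‖ ^ 2
      = ∑ i, ((∑ k, M i k * ((1 - δ k) * W.mulVec x k))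
          - ∑ l, (∑ k, M i k * (δ k * W k l)) * ε l) ^ 2 := by
    intro ε
    rw [EuclideanSpace.real_norm_sq_eq]
    refine Finset.sum_congr rfl fun i _ => ?_
    congr 1
    change x i - (M.mulVec ((Matrix.diagonal δ).mulVec (W.mulVec (x + ε)))) i = _
    have e1 : (M.mulVec ((Matrix.diagonal δ).mulVec (W.mulVec (x + ε)))) i
        = ∑ k, M i k * (δ k * (W.mulVec x k + ∑ l, W k l * ε l)) := by
      change ∑ k, M i k * ((Matrix.diagonal δ).mulVec (W.mulVec (x + ε))) k = _
      refine Finset.sum_congr rfl fun k _ => ?_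
      rw [Matrix.mulVec_diagonal, Matrix.mulVec_add]
      rfl
    have e2 : ∑ l, (∑ k, M i k * (δ k * W k l)) * ε l
        = ∑ k, M i k * (δ k * ∑ l, W k l * ε l) := by
      simp only [Finset.sum_mul, Finset.mul_sum]
      rw [Finset.sum_comm]
      refine Finset.sum_congr rfl fun k _ => Finset.sum_congr rfl fun l _ => ?_
      ring
    rw [e1, e2, hx i, ← Finset.sum_sub_distrib, ← Finset.sum_sub_distrib]
    refine Finset.sum_congr rfl fun k _ => ?_
    ring
  simp only [hpt]
  rw [integral_finsetSum _ fun i _ => aux_int n (σ ^ 2) _ _]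
  simp only [aux_risk]
  rw [Finset.sum_add_distrib, ← Finset.mul_sum, Finset.sum_comm (f := fun i l =>
    (∑ k, M i k * (δ k * W k l)) ^ 2)]
  simp only [aux_comb]
  have b1 : ∑ k, ∑ j, (1 - δ k) * W.mulVec x k * ((1 - δ j) * W.mulVec x j)
      * ∑ i, M i k * M i j ≤ ∑ k, (1 - δ k) * U k := by
    refine le_trans (le_of_eq ?_) (aux_bound (fun k => 1 - δ k) hδ'
      (fun k j => (W.mulVec x k) * (W.mulVec x j) * (∑ i, M i k * M i j)))
    refine Finset.sum_congr rfl fun k _ => Finset.sum_congr rfl fun j _ => ?_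
    ring
  have b2 : ((σ ^ 2 : ℝ≥0) : ℝ) * ∑ l, ∑ k, ∑ j, δ k * W k l * (δ j * W j l)
      * ∑ i, M i k * M i j ≤ ∑ k, δ k * S k := by
    have h := aux_bound δ hδ (fun k j => (∑ i, M i k * M i j) * (∑ i, W k i * W j i))
    have h2 : ∑ l, ∑ k, ∑ j, δ k * W k l * (δ j * W j l) * ∑ i, M i k * M i j
        = ∑ k, ∑ j, δ k * δ j * ((∑ i, M i k * M i j) * (∑ i, W k i * W j i)) := by
      rw [Finset.sum_comm]
      refine Finset.sum_congr rfl fun k _ => ?_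
      rw [Finset.sum_comm]
      refine Finset.sum_congr rfl fun j _ => ?_
      rw [Finset.mul_sum, Finset.mul_sum]
      refine Finset.sum_congr rfl fun l _ => ?_
      ring
    have h3 : ∑ k, δ k * S k = (σ : ℝ) ^ 2 * ∑ k, δ k *
        ∑ j, |(∑ i, M i k * M i j) * (∑ i, W k i * W j i)| := by
      rw [Finset.mul_sum]
      refine Finset.sum_congr rfl fun k _ => ?_
      simp only [hS]
      ring
    rw [h2, h3, NNReal.coe_pow]
    exact mul_le_mul_of_nonneg_left h (by positivity)
  refine (add_le_add b1 b2).trans (le_of_eq ?_)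
  rw [← Finset.sum_add_distrib]
  refine Finset.sum_congr rfl fun k _ => ?_
  change _ = min (U k) (S k)
  by_cases h : U k ≤ S k
  · simp [δ, h]
  · simp [δ, h, le_of_not_ge h]
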